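/- Let S be a primitive constant-length substitution of length L > 1 on a finite alphabet A and ν a fully supported product measure on S^ℕ, with unique invariant state μ_ν. Then there exist constants C, γ > 0 and n_0 ∈ ℕ such that for all a, b ∈ A and n ≥ n_0, |μ_ν([a]_1 ∩ [b]_n)/(μ_ν[a]_1 μ_ν[b]_n) − 1| ≤ C n^{−γ}. -/

import Mathlib

open MeasureTheory
open scoped Classical

def applySub {A S : Type*} (subst : S → A → List A) {N : ℕ}
    (s : Fin N → S) (b : Fin N → A) : List A :=
  (List.ofFn fun i => subst (s i) (b i)).flatten

def trunc {A : Type*} [Inhabited A] (N : ℕ) (w : List A) : Fin N → A :=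
  fun i => w.getD i.1 default

def chainT {A S : Type*} [Inhabited A] (subst : S → A → List A) {N : ℕ} :
    List (Fin N → S) → (Fin N → A) → (Fin N → A)
  | [], b => b
  | s :: rest, b => chainT subst rest (trunc N (applySub subst s b))

def PrimitiveSub {A S : Type*} [Inhabited A] (subst : S → A → List A) : Prop :=
  ∀ N : ℕ, ∃ nN : ℕ, ∀ n ≥ nN, ∀ a b : Fin N → A,
    ∃ ss : List (Fin N → S), ss.length = n ∧ chainT subst ss b = a

def cyl (A : Type*) {N : ℕ} (a : Fin N → A) : Set (ℕ → A) :=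
  {x | ∀ i : Fin N, x i.1 = a i}

theorem stochastic_pow_sub_le {A : Type*} [Fintype A] [DecidableEq A]
    (K : Matrix A A ℝ) (ϖ : A → ℝ) (ε : ℝ)
    (hK1 : ∀ a, ∑ b, K a b = 1) (hϖ : ∀ a, 0 ≤ ϖ a) (hϖ1 : ∑ a, ϖ a = 1)
    (hst : ∀ b, ∑ a, ϖ a * K a b = ϖ b) (hε : ε ≤ 1)
    (hmin : ∀ a b, ε * ϖ b ≤ K a b) (j : ℕ) (a b : A) :
    |(K ^ j) a b - ϖ b| ≤ (1 - ε) ^ j := by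
  have hrow : ∀ j : ℕ, ∀ a, ∑ b, (K ^ j) a b = 1 := by
    intro j
    induction j with
    | zero => intro a; simp [Matrix.one_apply]
    | succ j ih =>
      intro a
      simp only [pow_succ, Matrix.mul_apply]
      rw [Finset.sum_comm]
      simp [← Finset.mul_sum, hK1, ih]
  have hlow : ∀ j : ℕ, ∀ a b, (1 - (1 - ε) ^ j) * ϖ b ≤ (K ^ j) a b := by
    intro j
    induction j with
    | zero => intro a b; simp [Matrix.one_apply]; split_ifs <;> norm_num
    | succ j ih =>
      intro a b
      have h1 : ∑ c, ((K ^ j) a c - (1 - (1 - ε) ^ j) * ϖ c) * (ε * ϖ b) ≤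
          ∑ c, ((K ^ j) a c - (1 - (1 - ε) ^ j) * ϖ c) * K c b :=
        Finset.sum_le_sum fun c _ =>
          mul_le_mul_of_nonneg_left (hmin c b) (sub_nonneg.2 (ih a c))
      have h2 : ∑ c, ((K ^ j) a c - (1 - (1 - ε) ^ j) * ϖ c) * K c b =
          (K ^ (j + 1)) a b - (1 - (1 - ε) ^ j) * ϖ b := by
        rw [pow_succ, Matrix.mul_apply, ← hst b, Finset.mul_sum, ← Finset.sum_sub_distrib]
        exact Finset.sum_congr rfl fun c _ => by ring
      rw [← Finset.sum_mul, Finset.sum_sub_distrib, ← Finset.mul_sum, hrow, hϖ1, h2] at h1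
      rw [pow_succ]
      linarith
  have hd : 0 ≤ (1 - ε) ^ j := pow_nonneg (by linarith) j
  have hup : (K ^ j) a b - (1 - (1 - ε) ^ j) * ϖ b ≤ (1 - ε) ^ j := by
    calc _ ≤ ∑ c, ((K ^ j) a c - (1 - (1 - ε) ^ j) * ϖ c) :=
          Finset.single_le_sum (f := fun c => (K ^ j) a c - (1 - (1 - ε) ^ j) * ϖ c)
            (fun c _ => sub_nonneg.2 (hlow j a c)) (Finset.mem_univ b)
      _ = _ := by rw [Finset.sum_sub_distrib, ← Finset.mul_sum, hrow, hϖ1]; ring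
  have hb1 : ϖ b ≤ 1 := hϖ1 ▸ Finset.single_le_sum (fun c _ => hϖ c) (Finset.mem_univ b)
  have := hlow j a b
  rw [abs_le]
  constructor <;> nlinarith [hϖ b, mul_nonneg hd (hϖ b), mul_le_mul_of_nonneg_left hb1 hd]

theorem exists_pow_log_le_rpow {B : ℕ} (hB : 1 < B) {δ : ℝ} (h0 : 0 < δ) (h1 : δ < 1) :
    ∃ γ > (0 : ℝ), ∀ n ≥ 2, δ ^ (Nat.log B (n - 1)) ≤ δ⁻¹ * (n : ℝ) ^ (-γ) := by
  have hBr : (1 : ℝ) < B := by exact_mod_cast hB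
  have hlB : 0 < Real.log B := Real.log_pos hBr
  have hld : Real.log δ < 0 := Real.log_neg h0 h1
  refine ⟨-Real.log δ / Real.log B, div_pos (by linarith) hlB, fun n hn => ?_⟩
  set j := Nat.log B (n - 1)
  have hlt : n - 1 < B ^ (j + 1) := Nat.lt_pow_succ_log_self hB _
  have hle : (n : ℝ) ≤ (B : ℝ) ^ (j + 1) := by
    have : n ≤ B ^ (j + 1) := by omega
    exact_mod_cast this
  have hn0 : (0 : ℝ) < n := by exact_mod_cast (by omega : 0 < n)
  have hkey : ((B : ℝ) ^ (j + 1)) ^ (-(-Real.log δ / Real.log B)) = δ ^ (j + 1) := by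
    rw [neg_div, neg_neg, ← Real.rpow_natCast, ← Real.rpow_mul (by positivity), mul_comm,
      Real.rpow_mul (by positivity), Real.rpow_natCast]
    congr 1
    rw [Real.rpow_def_of_pos (by positivity), mul_div_cancel₀ _ hlB.ne', Real.exp_log h0]
  have hmono : δ ^ (j + 1) ≤ (n : ℝ) ^ (-(-Real.log δ / Real.log B)) := by
    rw [← hkey]
    exact Real.rpow_le_rpow_of_nonpos hn0 hle
      (neg_nonpos.2 (div_pos (by linarith) hlB).le)
  calc δ ^ j = δ⁻¹ * δ ^ (j + 1) := by rw [pow_succ]; field_simp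
    _ ≤ _ := by gcongr

theorem getD_flatten_of_length_eq {α : Type*} {L : ℕ} (hL : 0 < L) (d : α) (l : List (List α))
    (hl : ∀ w ∈ l, w.length = L) (i : ℕ) :
    l.flatten.getD i d = (l.getD (i / L) []).getD (i % L) d := by
  induction l generalizing i with
  | nil => simp
  | cons w l ih =>
    have hw : w.length = L := hl w (by simp)
    rw [List.flatten_cons]
    rcases lt_or_ge i L with h | h
    · rw [List.getD_append _ _ _ _ (by omega), Nat.div_eq_of_lt h, Nat.mod_eq_of_lt h]
      simp
    · rw [List.getD_append_right _ _ _ _ (by omega), hw,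
        ih (fun w hw => hl w (by simp [hw])), Nat.div_eq_sub_div hL h, Nat.mod_eq_sub_mod h]
      simp

section Substitution

variable {A S : Type*} {L : ℕ} {subst : S → A → List A}

theorem length_applySub (hlen : ∀ σ a, (subst σ a).length = L) {N : ℕ}
    (s : Fin N → S) (b : Fin N → A) : (applySub subst s b).length = N * L := by
  simp [applySub, List.length_flatten, List.map_ofFn, Function.comp_def, hlen]

variable [Inhabited A]

theorem getD_applySub (hL : 0 < L) (hlen : ∀ σ a, (subst σ a).length = L) {N : ℕ}
    (s : Fin N → S) (b : Fin N → A) (i : ℕ) (h : i / L < N) :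
    (applySub subst s b).getD i default =
      (subst (s ⟨i / L, h⟩) (b ⟨i / L, h⟩)).getD (i % L) default := by
  rw [applySub, getD_flatten_of_length_eq hL]
  · congr 1
    simp [List.getD_eq_getElem?_getD, h]
  · intro w hw
    obtain ⟨i, rfl⟩ := (List.mem_ofFn' _ _).1 hw
    exact hlen _ _

theorem ofFn_prefix_iff {N : ℕ} (a : Fin N → A) (w : List A) (hw : N ≤ w.length) :
    List.ofFn a <+: w ↔ a = trunc N w := by
  rw [List.prefix_iff_eq_take]
  constructor
  · intro h
    funext i
    have hi : i.1 < w.length := by omega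
    have := congrArg (fun l => l.getD i.1 default) h
    simpa [trunc, List.getD_eq_getElem?_getD, hi] using this
  · rintro rfl
    apply List.ext_getElem
    · simp [hw]
    · intro i h1 h2
      simp only [List.length_ofFn] at h1
      have hi : i < w.length := by omega
      simp [trunc, List.getD_eq_getElem?_getD, hi]

end Substitution

/-- Probability that the substituted word of `b`, with substitution law `q`, has letter `a` at
position `r`. -/
noncomputable def letterKernel {A S : Type*} [DecidableEq A] [Inhabited A] [Fintype S]
    (subst : S → A → List A) (q : S → ℝ) (r : ℕ) : Matrix A A ℝ :=
  fun b a => ∑ σ, q σ * if (subst σ b).getD r default = a then 1 else 0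

section Kernel

variable {A S : Type*} [DecidableEq A] [Inhabited A] [Fintype S]
  (subst : S → A → List A)

theorem letterKernel_nonneg {q : S → ℝ} (hq : ∀ σ, 0 < q σ) (r : ℕ) (b a : A) :
    0 ≤ letterKernel subst q r b a :=
  Finset.sum_nonneg fun σ _ => mul_nonneg (hq σ).le (by split_ifs <;> norm_num)

variable [Fintype A]

theorem sum_letterKernel {q : S → ℝ} (hq1 : ∑ σ, q σ = 1) (r : ℕ) (b : A) :
    ∑ a, letterKernel subst q r b a = 1 := by
  simp only [letterKernel]
  rw [Finset.sum_comm]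
  simp [hq1]

theorem letterKernel_pow_nonneg {q : S → ℝ} (hq : ∀ σ, 0 < q σ) (r k : ℕ) (b a : A) :
    0 ≤ (letterKernel subst q r ^ k) b a := by
  induction k generalizing b a with
  | zero => simp only [pow_zero, Matrix.one_apply]; split_ifs <;> norm_num
  | succ k ih =>
    rw [pow_succ, Matrix.mul_apply]
    exact Finset.sum_nonneg fun c _ => mul_nonneg (ih _ _) (letterKernel_nonneg subst hq _ _ _)

theorem sum_letterKernel_pow {q : S → ℝ} (hq1 : ∑ σ, q σ = 1) (r k : ℕ) (b : A) :
    ∑ a, (letterKernel subst q r ^ k) b a = 1 := by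
  induction k generalizing b with
  | zero => simp [Matrix.one_apply]
  | succ k ih =>
    simp only [pow_succ, Matrix.mul_apply]
    rw [Finset.sum_comm]
    simp [← Finset.mul_sum, sum_letterKernel subst hq1, ih]

theorem letterKernel_pow_chainT_pos {L : ℕ} (hL : 0 < L)
    (hlen : ∀ σ a, (subst σ a).length = L) {q : S → ℝ}
    (hq : ∀ σ, 0 < q σ) (ss : List (Fin 1 → S)) (b : Fin 1 → A) :
    0 < (letterKernel subst q 0 ^ ss.length) (b 0) (chainT subst ss b 0) := by
  induction ss generalizing b with
  | nil => simp [chainT]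
  | cons s ss ih =>
    rw [List.length_cons, pow_succ', Matrix.mul_apply]
    set b' := trunc 1 (applySub subst s b) with hb'
    have hval : b' 0 = (subst (s 0) (b 0)).getD 0 default := by
      have := getD_applySub hL hlen s b 0 (by simp)
      simpa [hb', trunc] using this
    have hpos : 0 < letterKernel subst q 0 (b 0) (b' 0) := by
      refine Finset.sum_pos' (fun σ _ => mul_nonneg (hq σ).le (by split_ifs <;> norm_num))
        ⟨s 0, Finset.mem_univ _, ?_⟩
      rw [if_pos hval.symm, mul_one]
      exact hq _
    refine Finset.sum_pos' (fun c _ => mul_nonneg (letterKernel_nonneg subst hq _ _ _)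
      (letterKernel_pow_nonneg subst hq _ _ _ _)) ⟨b' 0, Finset.mem_univ _, ?_⟩
    exact mul_pos hpos (ih b')

theorem exists_letterKernel_pow_pos {L : ℕ} (hL : 0 < L)
    (hlen : ∀ σ a, (subst σ a).length = L) (hprim : PrimitiveSub subst) {q : S → ℝ}
    (hq : ∀ σ, 0 < q σ) :
    ∃ k > 0, ∀ b a, 0 < (letterKernel subst q 0 ^ k) b a := by
  obtain ⟨m, hm⟩ := hprim 1
  refine ⟨max m 1, by simp, fun b a => ?_⟩
  obtain ⟨ss, hss, hc⟩ := hm (max m 1) (le_max_left _ _) (fun _ => a) (fun _ => b)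
  have := letterKernel_pow_chainT_pos subst hL hlen hq ss (fun _ => b)
  rwa [hss, hc] at this

end Kernel

theorem sum_pi_prod_mul_mul {S : Type*} [Fintype S] {N : ℕ} (p : Fin N → S → ℝ)
    (hp1 : ∀ i, ∑ σ, p i σ = 1) {i j : Fin N} (hij : i ≠ j) (f g : S → ℝ) :
    ∑ s : Fin N → S, (∏ k, p k (s k)) * (f (s i) * g (s j)) =
      (∑ σ, p i σ * f σ) * ∑ σ, p j σ * g σ := by
  have h := Finset.prod_univ_sum (fun _ : Fin N => (Finset.univ : Finset S))
    (fun k σ => p k σ * ((if k = i then f σ else 1) * (if k = j then g σ else 1)))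
  rw [Fintype.piFinset_univ] at h
  simp only [Finset.prod_mul_distrib, Finset.prod_ite_eq', Finset.mem_univ, if_true] at h
  rw [← h, ← Finset.mul_prod_erase _ _ (Finset.mem_univ i),
    ← Finset.mul_prod_erase _ _ (Finset.mem_erase.2 ⟨hij.symm, Finset.mem_univ j⟩),
    Finset.prod_eq_one, mul_one]
  · simp [hij, hij.symm]
  · intro k hk
    simp only [Finset.mem_erase] at hk
    simp [hk.1, hk.2.1, hp1]

section Invariant

variable {A : Type*} [Fintype A] [MeasurableSpace A] [MeasurableSingletonClass A]
  (μν : Measure (ℕ → A)) [IsProbabilityMeasure μν]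

/-- Joint law of the letters at positions `0` and `n`. -/
noncomputable def pairLaw (n : ℕ) : Matrix A A ℝ :=
  fun a b => (μν {x | x 0 = a ∧ x n = b}).toReal

theorem sum_pairLaw_left (n : ℕ) (b : A) :
    ∑ a, pairLaw μν n a b = (μν {x | x n = b}).toReal := by
  have h := measureReal_biUnion_finset (μ := μν) (s := Finset.univ)
    (f := fun a : A => {x : ℕ → A | x 0 = a ∧ x n = b})
    (fun a _ a' _ haa => Set.disjoint_left.2 fun x hx hx' => haa (hx.1.symm.trans hx'.1))
    (fun a _ => by
      exact ((measurableSet_singleton a).preimage (measurable_pi_apply 0)).inter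
        (measurableSet_singleton b |>.preimage (measurable_pi_apply n)))
  simp only [Measure.real] at h
  simp only [pairLaw]
  rw [← h]
  congr 2
  ext x
  simp

theorem sum_pairLaw_right (n : ℕ) (a : A) :
    ∑ b, pairLaw μν n a b = (μν {x | x 0 = a}).toReal := by
  have h := measureReal_biUnion_finset (μ := μν) (s := Finset.univ)
    (f := fun b : A => {x : ℕ → A | x 0 = a ∧ x n = b})
    (fun b _ b' _ hbb => Set.disjoint_left.2 fun x hx hx' => hbb (hx.2.symm.trans hx'.2))
    (fun b _ => by
      exact ((measurableSet_singleton a).preimage (measurable_pi_apply 0)).inter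
        (measurableSet_singleton b |>.preimage (measurable_pi_apply n)))
  simp only [Measure.real] at h
  simp only [pairLaw]
  rw [← h]
  congr 2
  ext x
  simp

variable [DecidableEq A]

theorem pairLaw_eq_sum {N : ℕ} (i j : Fin N) (hi : i.1 = 0) (a b : A) :
    pairLaw μν j.1 a b =
      ∑ w : Fin N → A, if w i = a ∧ w j = b then (μν (cyl A w)).toReal else 0 := by
  have hcyl : ∀ w : Fin N → A, cyl A w = (fun (x : ℕ → A) (k : Fin N) => x k.1) ⁻¹' {w} := by
    intro w; ext x; simp [cyl, funext_iff]
  have hm : Measurable (fun (x : ℕ → A) (k : Fin N) => x k.1) := by fun_prop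
  have h := sum_measureReal_preimage_singleton (μ := μν)
    (Finset.univ.filter fun w : Fin N → A => w i = a ∧ w j = b)
    (f := fun (x : ℕ → A) (k : Fin N) => x k.1)
    (fun w _ => hm (measurableSet_singleton w))
  rw [Finset.sum_filter] at h
  simp only [← hcyl, Measure.real] at h
  rw [h, pairLaw]
  congr 2
  ext x
  simp [hi]

variable [Inhabited A] {S : Type*} [Fintype S] {L : ℕ} {subst : S → A → List A} {p : ℕ → S → ℝ}

theorem pairLaw_recursion (hL : 1 < L) (hlen : ∀ σ a, (subst σ a).length = L)
    (hp1 : ∀ n, ∑ σ : S, p n σ = 1)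
    (hinv : ∀ (N : ℕ) (a : Fin N → A), (μν (cyl A a)).toReal =
      ∑ s : Fin N → S, ∑ b : Fin N → A,
        if List.ofFn a <+: applySub subst s b then
          (∏ i : Fin N, p i.1 (s i)) * (μν (cyl A b)).toReal else 0)
    {n : ℕ} (hn : L ≤ n) :
    pairLaw μν n = (letterKernel subst (p 0) 0).transpose *
      (pairLaw μν (n / L) * letterKernel subst (p (n / L)) (n % L)) := by
  have hL0 : 0 < L := by omega
  have hm0 : 0 < n / L := Nat.div_pos hn hL0
  have hmn : n / L < n + 1 := Nat.lt_succ_of_le (Nat.div_le_self _ _)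
  set m : Fin (n + 1) := ⟨n / L, hmn⟩ with hm
  have hne : (0 : Fin (n + 1)) ≠ m := by
    intro h
    have := congrArg Fin.val h
    simp [hm] at this
    omega
  have hpre : ∀ (s : Fin (n + 1) → S) (c w : Fin (n + 1) → A),
      List.ofFn w <+: applySub subst s c ↔ w = trunc (n + 1) (applySub subst s c) := by
    intro s c w
    apply ofFn_prefix_iff
    rw [length_applySub hlen]
    exact Nat.le_mul_of_pos_right _ hL0
  have ht0 : ∀ (s : Fin (n + 1) → S) (c : Fin (n + 1) → A),
      trunc (n + 1) (applySub subst s c) 0 = (subst (s 0) (c 0)).getD 0 default := by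
    intro s c
    have := getD_applySub hL0 hlen s c 0 (by simp)
    simpa [trunc] using this
  have htn : ∀ (s : Fin (n + 1) → S) (c : Fin (n + 1) → A),
      trunc (n + 1) (applySub subst s c) (Fin.last n) =
        (subst (s m) (c m)).getD (n % L) default := by
    intro s c
    simpa [trunc] using getD_applySub hL0 hlen s c n hmn
  have hstep : ∀ a b, pairLaw μν n a b = ∑ c : Fin (n + 1) → A,
      letterKernel subst (p 0) 0 (c 0) a * letterKernel subst (p (n / L)) (n % L) (c m) b *
        (μν (cyl A c)).toReal := by
    intro a b
    have h1 : pairLaw μν n a b = ∑ w : Fin (n + 1) → A,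
        if w 0 = a ∧ w (Fin.last n) = b then (μν (cyl A w)).toReal else 0 :=
      pairLaw_eq_sum μν (0 : Fin (n + 1)) (Fin.last n) rfl a b
    have h2 : ∀ w : Fin (n + 1) → A,
        (if w 0 = a ∧ w (Fin.last n) = b then (μν (cyl A w)).toReal else 0) =
        ∑ c : Fin (n + 1) → A, ∑ s : Fin (n + 1) → S,
          if w = trunc (n + 1) (applySub subst s c) then
            (if w 0 = a ∧ w (Fin.last n) = b then
              (∏ i : Fin (n + 1), p i.1 (s i)) * (μν (cyl A c)).toReal else 0) else 0 := by
      intro w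
      split_ifs with h
      · rw [hinv, Finset.sum_comm]
        simp only [hpre]
      · simp
    rw [h1, Finset.sum_congr rfl fun w _ => h2 w, Finset.sum_comm]
    refine Finset.sum_congr rfl fun c _ => ?_
    rw [Finset.sum_comm]
    simp only [Finset.sum_ite_eq', Finset.mem_univ, if_true, ht0, htn]
    have h3 := sum_pi_prod_mul_mul (fun i : Fin (n + 1) => p i.1) (fun i => hp1 i.1) hne
      (fun σ => if (subst σ (c 0)).getD 0 default = a then (1 : ℝ) else 0)
      (fun σ => if (subst σ (c m)).getD (n % L) default = b then (1 : ℝ) else 0)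
    simp only [letterKernel]
    have h4 : (m : ℕ) = n / L := rfl
    rw [Fin.val_zero, h4] at h3
    rw [← h3, Finset.sum_mul]
    refine Finset.sum_congr rfl fun s _ => ?_
    rw [ite_and]
    split_ifs <;> simp
  ext a b
  have hpl : ∀ a' b', pairLaw μν (n / L) a' b' = _ :=
    fun a' b' => pairLaw_eq_sum μν (0 : Fin (n + 1)) m rfl a' b'
  rw [hstep]
  simp only [Matrix.mul_apply, Matrix.transpose_apply, hpl, Finset.mul_sum, Finset.sum_mul]
  rw [Finset.sum_congr rfl fun a' _ => Finset.sum_comm, Finset.sum_comm]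
  refine Finset.sum_congr rfl fun c _ => ?_
  rw [Finset.sum_eq_single (c 0), Finset.sum_eq_single (c m)]
  · simp; ring
  · intro b' _ hb; simp [hb.symm]
  · simp
  · intro a' _ ha; simp [ha.symm]
  · simp

theorem exists_pairLaw_eq_pow_mul (hL : 1 < L) (hlen : ∀ σ a, (subst σ a).length = L)
    (hp : ∀ n σ, 0 < p n σ) (hp1 : ∀ n, ∑ σ : S, p n σ = 1)
    (hinv : ∀ (N : ℕ) (a : Fin N → A), (μν (cyl A a)).toReal =
      ∑ s : Fin N → S, ∑ b : Fin N → A,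
        if List.ofFn a <+: applySub subst s b then
          (∏ i : Fin N, p i.1 (s i)) * (μν (cyl A b)).toReal else 0)
    (k : ℕ) {n : ℕ} (hn : L ^ k ≤ n) :
    ∃ Y : Matrix A A ℝ, (∀ a b, 0 ≤ Y a b) ∧
      pairLaw μν n = (letterKernel subst (p 0) 0 ^ k).transpose * Y := by
  induction k generalizing n with
  | zero => exact ⟨pairLaw μν n, fun a b => ENNReal.toReal_nonneg, by simp⟩
  | succ k ih =>
    have hL0 : 0 < L := by omega
    have hLn : L ≤ n := (Nat.le_self_pow (by omega) L).trans hn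
    obtain ⟨Y, hY, hJ⟩ := ih (n := n / L) ((Nat.le_div_iff_mul_le hL0).2 (by rwa [← pow_succ]))
    refine ⟨Y * letterKernel subst (p (n / L)) (n % L), fun a b => ?_, ?_⟩
    · rw [Matrix.mul_apply]
      exact Finset.sum_nonneg fun c _ =>
        mul_nonneg (hY _ _) (letterKernel_nonneg subst (hp _) _ _ _)
    · rw [pairLaw_recursion μν hL hlen hp1 hinv hLn, hJ, pow_succ, Matrix.transpose_mul]
      simp only [Matrix.mul_assoc]

theorem stationary_letterKernel (hL : 1 < L) (hlen : ∀ σ a, (subst σ a).length = L)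
    (hp1 : ∀ n, ∑ σ : S, p n σ = 1)
    (hinv : ∀ (N : ℕ) (a : Fin N → A), (μν (cyl A a)).toReal =
      ∑ s : Fin N → S, ∑ b : Fin N → A,
        if List.ofFn a <+: applySub subst s b then
          (∏ i : Fin N, p i.1 (s i)) * (μν (cyl A b)).toReal else 0)
    (a : A) :
    ∑ a', (μν {x | x 0 = a'}).toReal * letterKernel subst (p 0) 0 a' a =
      (μν {x | x 0 = a}).toReal := by
  have h := pairLaw_recursion μν hL hlen hp1 hinv le_rfl
  rw [← sum_pairLaw_right μν L a, h]
  simp only [Matrix.mul_apply, Matrix.transpose_apply]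
  rw [Finset.sum_comm]
  refine Finset.sum_congr rfl fun a' _ => ?_
  rw [← Finset.mul_sum, Finset.sum_comm]
  simp only [← Finset.mul_sum, sum_letterKernel subst (hp1 _), mul_one]
  rw [sum_pairLaw_right, mul_comm]

theorem stationary_letterKernel_pow (hL : 1 < L) (hlen : ∀ σ a, (subst σ a).length = L)
    (hp1 : ∀ n, ∑ σ : S, p n σ = 1)
    (hinv : ∀ (N : ℕ) (a : Fin N → A), (μν (cyl A a)).toReal =
      ∑ s : Fin N → S, ∑ b : Fin N → A,
        if List.ofFn a <+: applySub subst s b then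
          (∏ i : Fin N, p i.1 (s i)) * (μν (cyl A b)).toReal else 0)
    (k : ℕ) (a : A) :
    ∑ a', (μν {x | x 0 = a'}).toReal * (letterKernel subst (p 0) 0 ^ k) a' a =
      (μν {x | x 0 = a}).toReal := by
  induction k generalizing a with
  | zero => simp [Matrix.one_apply]
  | succ k ih =>
    simp only [pow_succ, Matrix.mul_apply, Finset.mul_sum]
    rw [Finset.sum_comm]
    simp only [← mul_assoc, ← Finset.sum_mul, ih]
    exact stationary_letterKernel μν hL hlen hp1 hinv a

theorem exists_abs_letterKernel_pow_sub_le (hL : 1 < L) (hlen : ∀ σ a, (subst σ a).length = L)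
    (hprim : PrimitiveSub subst)
    (hp : ∀ n σ, 0 < p n σ) (hp1 : ∀ n, ∑ σ : S, p n σ = 1)
    (hpos : ∀ a, 0 < (μν {x | x 0 = a}).toReal)
    (hinv : ∀ (N : ℕ) (a : Fin N → A), (μν (cyl A a)).toReal =
      ∑ s : Fin N → S, ∑ b : Fin N → A,
        if List.ofFn a <+: applySub subst s b then
          (∏ i : Fin N, p i.1 (s i)) * (μν (cyl A b)).toReal else 0) :
    ∃ C > (0 : ℝ), ∃ δ > (0 : ℝ), δ < 1 ∧ ∃ k > 0, ∀ j a' a,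
      |(letterKernel subst (p 0) 0 ^ (k * j)) a' a - (μν {x | x 0 = a}).toReal| ≤
        C * δ ^ j * (μν {x | x 0 = a}).toReal := by
  obtain ⟨k, hk, hKpos⟩ := exists_letterKernel_pow_pos subst (by omega) hlen hprim (hp 0)
  obtain ⟨q, hq⟩ := Finite.exists_min
    fun q : A × A => (letterKernel subst (p 0) 0 ^ k) q.1 q.2
  obtain ⟨a₀, ha₀⟩ := Finite.exists_min fun a : A => (μν {x | x 0 = a}).toReal
  have hle1 : ∀ a, (μν {x | x 0 = a}).toReal ≤ 1 := fun a => measureReal_le_one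
  have hsum1 : ∑ a, (μν {x | x 0 = a}).toReal = 1 := by
    have h := sum_measureReal_preimage_singleton (μ := μν) (Finset.univ : Finset A)
      (f := fun x : ℕ → A => x 0)
      (fun a _ => (measurable_pi_apply 0) (measurableSet_singleton a))
    simp only [Finset.coe_univ, Set.preimage_univ, probReal_univ] at h
    exact h
  set ε : ℝ := min ((letterKernel subst (p 0) 0 ^ k) q.1 q.2) (1 / 2) with hε
  have hε0 : 0 < ε := lt_min (hKpos _ _) (by norm_num)
  have hε2 : ε ≤ 1 / 2 := min_le_right _ _
  refine ⟨((μν {x | x 0 = a₀}).toReal)⁻¹, inv_pos.2 (hpos a₀), 1 - ε, by linarith, by linarith,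
    k, hk, fun j a' a => ?_⟩
  have h := stochastic_pow_sub_le (letterKernel subst (p 0) 0 ^ k)
    (fun a => (μν {x | x 0 = a}).toReal) ε (sum_letterKernel_pow subst (hp1 0) 0 k)
    (fun a => (hpos a).le) hsum1 (stationary_letterKernel_pow μν hL hlen hp1 hinv k)
    (by linarith)
    (fun a b => (mul_le_of_le_one_right hε0.le (hle1 b)).trans
      ((min_le_left _ _).trans (hq (a, b)))) j a' a
  rw [← pow_mul] at h
  refine h.trans ?_
  have hd : 0 ≤ (1 - ε) ^ j := pow_nonneg (by linarith) j
  rw [mul_right_comm]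
  refine le_mul_of_one_le_left hd ?_
  rw [inv_mul_eq_div, one_le_div (hpos a₀)]
  exact ha₀ a

end Invariant

/-- decay of correlations: for a primitive constant-length substitution of
length L > 1 and a fully supported product measure ν on S^ℕ (with one-site marginals p),
the unique invariant state μ_ν satisfies
|μ_ν([a]_1 ∩ [b]_n)/(μ_ν[a]_1 μ_ν[b]_n) − 1| ≤ C n^{−γ} for all n ≥ n₀.
Positions are indexed from 0, so [a]_1 = {x | x 0 = a} and [b]_n = {x | x (n−1) = b}. -/
theorem stmt7 {A S : Type*} [Fintype A] [DecidableEq A] [Inhabited A] [Nonempty A]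
    [MeasurableSpace A] [MeasurableSingletonClass A]
    [Fintype S] [DecidableEq S] [Nonempty S]
    (L : ℕ) (hL : 1 < L)
    (subst : S → A → List A) (hlen : ∀ σ a, (subst σ a).length = L)
    (hprim : PrimitiveSub subst)
    (p : ℕ → S → ℝ) (hp : ∀ n σ, 0 < p n σ) (hp1 : ∀ n, ∑ σ : S, p n σ = 1)
    (μν : Measure (ℕ → A)) [IsProbabilityMeasure μν]
    (hfs : ∀ (N : ℕ) (a : Fin N → A), 0 < μν (cyl A a))
    (hinv : ∀ (N : ℕ) (a : Fin N → A), (μν (cyl A a)).toReal =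
      ∑ s : Fin N → S, ∑ b : Fin N → A,
        if List.ofFn a <+: applySub subst s b then
          (∏ i : Fin N, p i.1 (s i)) * (μν (cyl A b)).toReal else 0) :
    ∃ C > (0 : ℝ), ∃ γ > (0 : ℝ), ∃ n₀ : ℕ, ∀ n ≥ n₀, ∀ a b : A,
      |(μν {x | x 0 = a ∧ x (n - 1) = b}).toReal /
          ((μν {x | x 0 = a}).toReal * (μν {x | x (n - 1) = b}).toReal) - 1| ≤
        C * (n : ℝ) ^ (-γ) := by
  have hsing : ∀ n (b : A), 0 < (μν {x | x n = b}).toReal := by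
    intro n b
    refine ENNReal.toReal_pos (fun h => ?_) (measure_ne_top _ _)
    refine (hfs (n + 1) fun _ => b).ne' (measure_mono_null (fun x hx => ?_) h)
    exact hx (Fin.last n)
  obtain ⟨C, hC, δ, hδ0, hδ1, k, hk, hbound⟩ := exists_abs_letterKernel_pow_sub_le μν hL hlen
    hprim hp hp1 (hsing 0) hinv
  obtain ⟨γ, hγ, hlog⟩ := exists_pow_log_le_rpow (Nat.one_lt_pow hk.ne' hL) hδ0 hδ1
  refine ⟨C * δ⁻¹, by positivity, γ, hγ, 2, fun n hn a b => ?_⟩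
  set j := Nat.log (L ^ k) (n - 1) with hj
  have hjn : L ^ (k * j) ≤ n - 1 := by
    rw [pow_mul]
    exact Nat.pow_log_le_self _ (by omega)
  obtain ⟨Y, hY, hJ⟩ := exists_pairLaw_eq_pow_mul μν hL hlen hp hp1 hinv (k * j) hjn
  have hJab : ∀ a, (μν {x | x 0 = a ∧ x (n - 1) = b}).toReal =
      ∑ a', (letterKernel subst (p 0) 0 ^ (k * j)) a' a * Y a' b := by
    intro a
    have := congrFun (congrFun hJ a) b
    simpa only [pairLaw, Matrix.mul_apply, Matrix.transpose_apply] using this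
  have hM : (μν {x | x (n - 1) = b}).toReal = ∑ a', Y a' b := by
    rw [← sum_pairLaw_left]
    simp only [pairLaw, hJab]
    rw [Finset.sum_comm]
    simp only [← Finset.sum_mul, sum_letterKernel_pow subst (hp1 0), one_mul]
  have h0 := hsing 0 a
  have h1 := hsing (n - 1) b
  rw [div_sub_one (mul_pos h0 h1).ne', abs_div, abs_of_pos (mul_pos h0 h1),
    div_le_iff₀ (mul_pos h0 h1)]
  calc |(μν {x | x 0 = a ∧ x (n - 1) = b}).toReal -
        (μν {x | x 0 = a}).toReal * (μν {x | x (n - 1) = b}).toReal|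
      = |∑ a', ((letterKernel subst (p 0) 0 ^ (k * j)) a' a -
          (μν {x | x 0 = a}).toReal) * Y a' b| := by
        simp only [hJab, hM, sub_mul, Finset.sum_sub_distrib, Finset.mul_sum]
    _ ≤ ∑ a', C * δ ^ j * (μν {x | x 0 = a}).toReal * Y a' b := by
        refine (Finset.abs_sum_le_sum_abs _ _).trans (Finset.sum_le_sum fun a' _ => ?_)
        rw [abs_mul, abs_of_nonneg (hY a' b)]
        exact mul_le_mul_of_nonneg_right (hbound j a' a) (hY a' b)
    _ = C * δ ^ j * ((μν {x | x 0 = a}).toReal * (μν {x | x (n - 1) = b}).toReal) := by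
        rw [← Finset.mul_sum, hM, mul_assoc]
    _ ≤ C * δ⁻¹ * (n : ℝ) ^ (-γ) *
          ((μν {x | x 0 = a}).toReal * (μν {x | x (n - 1) = b}).toReal) := by
        rw [mul_assoc C δ⁻¹]
        gcongr
        exact hlog n hn
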